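/- There is an absolute constant C such that for all ν ≥ 0, T > 0, k ∈ ℤ, and all u₀ ∈ L¹(ℝ) whose Fourier transform is supported in [k-1, k+1], one has ( ∫_ℝ ( sup_{0 ≤ t ≤ T} |(G_ν(t)u₀)(x)| )² dx )^{1/2} ≤ C (1+|k|)^{1/2} log(4(1+T)) ‖u₀‖_{L¹(ℝ)}. -/

import Mathlib

open MeasureTheory

noncomputable section

/-- `e r = exp (i r)`. -/
def e (r : ℝ) : ℂ := Complex.exp (Complex.I * (r : ℂ))

/-- The Fourier transform on `ℝ`: `𝓕 f (ξ) = ∫ e^{-ixξ} f x dx`. -/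
def FT1 (f : ℝ → ℂ) (ξ : ℝ) : ℂ := ∫ y : ℝ, e (-(y * ξ)) * f y

theorem norm_e (r : ℝ) : ‖e r‖ = 1 := by
  rw [e, mul_comm, Complex.norm_exp_ofReal_mul_I]

theorem e_add (r s : ℝ) : e (r + s) = e r * e s := by
  simp [e, mul_add, Complex.exp_add]

@[fun_prop]
theorem continuous_e : Continuous e := by
  unfold e
  fun_prop

/-- The integrand `e^{ixξ - itξ² - sξ²}` of the Ginzburg–Landau kernel. -/
def glIntegrand (s t x ξ : ℝ) : ℂ := e (x * ξ - t * ξ ^ 2) * (Real.exp (-(s * ξ ^ 2)) : ℂ)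

@[fun_prop]
theorem continuous_glIntegrand (s t x : ℝ) : Continuous (glIntegrand s t x) := by
  unfold glIntegrand
  fun_prop

theorem norm_glIntegrand_le_one {s : ℝ} (hs : 0 ≤ s) (t x ξ : ℝ) : ‖glIntegrand s t x ξ‖ ≤ 1 := by
  rw [glIntegrand, norm_mul, norm_e, one_mul, Complex.norm_real, Real.norm_eq_abs, Real.abs_exp,
    Real.exp_le_one_iff]
  nlinarith [mul_nonneg hs (sq_nonneg ξ)]

theorem norm_integral_glIntegrand_le_sub {s : ℝ} (hs : 0 ≤ s) (t x : ℝ) {a b : ℝ} (hab : a ≤ b) :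
    ‖∫ ξ in a..b, glIntegrand s t x ξ‖ ≤ b - a := by
  have := intervalIntegral.norm_integral_le_of_norm_le_const (a := a) (b := b) (C := 1)
    fun ξ _ => norm_glIntegrand_le_one hs t x ξ
  rwa [one_mul, abs_of_nonneg (sub_nonneg.2 hab)] at this

theorem hasDerivAt_exp_neg_mul_sq (s ξ : ℝ) : HasDerivAt (fun ξ : ℝ => Real.exp (-(s * ξ ^ 2)))
    (-(2 * s * ξ * Real.exp (-(s * ξ ^ 2)))) ξ := by
  refine ((hasDerivAt_pow 2 ξ).const_mul s).fun_neg.exp.congr_deriv ?_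
  simp
  ring

/-- The Gaussian `e^{-sξ²}` has total variation at most `2`. -/
theorem integral_abs_deriv_gaussian_le_two {s : ℝ} (hs : 0 ≤ s) {a b : ℝ} (hab : a ≤ b) :
    ∫ ξ in a..b, 2 * s * |ξ| * Real.exp (-(s * ξ ^ 2)) ≤ 2 := by
  set f : ℝ → ℝ := fun ξ => 2 * s * |ξ| * Real.exp (-(s * ξ ^ 2)) with hf
  have hc : Continuous f := by fun_prop
  set R : ℝ := max |a| |b|
  have hR : 0 ≤ R := (abs_nonneg a).trans (le_max_left _ _)
  have hpos : ∫ ξ in (0 : ℝ)..R, f ξ ≤ 1 := by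
    have h : ∫ ξ in (0 : ℝ)..R, f ξ = ∫ ξ in (0 : ℝ)..R, 2 * s * ξ * Real.exp (-(s * ξ ^ 2)) := by
      refine intervalIntegral.integral_congr fun ξ hξ => ?_
      rw [Set.uIcc_of_le hR] at hξ
      simp only [hf, abs_of_nonneg hξ.1]
    rw [h, intervalIntegral.integral_eq_sub_of_hasDerivAt
      (f := fun ξ => -Real.exp (-(s * ξ ^ 2)))
      (fun ξ _ => by simpa using (hasDerivAt_exp_neg_mul_sq s ξ).fun_neg)
      (Continuous.intervalIntegrable (by fun_prop) _ _)]
    have := Real.exp_pos (-(s * R ^ 2))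
    simp; linarith
  have hneg : ∫ ξ in (-R)..0, f ξ = ∫ ξ in (0 : ℝ)..R, f ξ := by
    have := intervalIntegral.integral_comp_neg (a := 0) (b := R) f
    rw [neg_zero] at this
    rw [← this]
    simp [hf]
  calc ∫ ξ in a..b, f ξ ≤ ∫ ξ in (-R)..R, f ξ := by
        refine intervalIntegral.integral_mono_interval ?_ hab ?_
          (Filter.Eventually.of_forall fun ξ => ?_) (hc.intervalIntegrable _ _)
        · linarith [neg_abs_le a, le_max_left |a| |b|]
        · linarith [le_abs_self b, le_max_right |a| |b|]
        · simp only [hf, Pi.zero_apply]; positivity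
    _ = (∫ ξ in (-R)..0, f ξ) + ∫ ξ in (0 : ℝ)..R, f ξ :=
        (intervalIntegral.integral_add_adjacent_intervals (hc.intervalIntegrable _ _)
          (hc.intervalIntegrable _ _)).symm
    _ ≤ 2 := by rw [hneg]; linarith

/-- First derivative test: the phase `xξ - tξ²` has derivative `x - 2tξ`. -/
theorem norm_integral_glIntegrand_le_of_le_abs_deriv {s t x a b l : ℝ} (hs : 0 ≤ s) (ht : 0 ≤ t)
    (hab : a ≤ b) (hl : 0 < l) (hq : ∀ ξ ∈ Set.Icc a b, l ≤ |x - 2 * t * ξ|) :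
    ‖∫ ξ in a..b, glIntegrand s t x ξ‖ ≤ 6 / l := by
  have huIcc : Set.uIcc a b = Set.Icc a b := Set.uIcc_of_le hab
  have hq0 (ξ) (hξ : ξ ∈ Set.Icc a b) : x - 2 * t * ξ ≠ 0 :=
    abs_pos.1 (hl.trans_le (hq ξ hξ))
  have hqinv (ξ) (hξ : ξ ∈ Set.Icc a b) : |(x - 2 * t * ξ)⁻¹| ≤ 1 / l := by
    rw [abs_inv, ← one_div]
    exact one_div_le_one_div_of_le hl (hq ξ hξ)
  have hqd (ξ : ℝ) : HasDerivAt (fun ξ : ℝ => x - 2 * t * ξ) (-(2 * t)) ξ := by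
    simpa using ((hasDerivAt_id ξ).const_mul (2 * t)).const_sub x
  set g : ℝ → ℝ := fun ξ => Real.exp (-(s * ξ ^ 2)) with hg
  have hg1 (ξ : ℝ) : |g ξ| ≤ 1 := by
    rw [hg, Real.abs_exp, Real.exp_le_one_iff]
    nlinarith [mul_nonneg hs (sq_nonneg ξ)]
  have hgd (ξ : ℝ) : HasDerivAt g (-(2 * s * ξ * g ξ)) ξ :=
    hasDerivAt_exp_neg_mul_sq s ξ
  set E : ℝ → ℂ := fun ξ => e (x * ξ - t * ξ ^ 2) with hE
  have hEd (ξ : ℝ) : HasDerivAt E (Complex.I * ((x - 2 * t * ξ : ℝ) : ℂ) * E ξ) ξ := by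
    have h1 : HasDerivAt (fun ξ : ℝ => x * ξ - t * ξ ^ 2) (x - 2 * t * ξ) ξ := by
      refine (((hasDerivAt_id' ξ).const_mul x).fun_sub
        ((hasDerivAt_pow 2 ξ).const_mul t)).congr_deriv ?_
      simp
      ring
    exact (h1.ofReal_comp.const_mul Complex.I).cexp.congr_deriv (mul_comm _ _)
  set h' : ℝ → ℝ := fun ξ => -(2 * s * ξ * g ξ) * (x - 2 * t * ξ)⁻¹ +
    g ξ * (2 * t * (x - 2 * t * ξ)⁻¹ ^ 2)
  have hinvd (ξ) (hξ : ξ ∈ Set.Icc a b) : HasDerivAt (fun ξ : ℝ => (x - 2 * t * ξ)⁻¹)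
      (2 * t * (x - 2 * t * ξ)⁻¹ ^ 2) ξ := by
    refine ((hqd ξ).fun_inv (hq0 ξ hξ)).congr_deriv ?_
    rw [neg_neg, inv_pow, div_eq_mul_inv]
  have hud (ξ) (hξ : ξ ∈ Set.uIcc a b) : HasDerivAt
      (fun ξ : ℝ => -Complex.I * ((g ξ * (x - 2 * t * ξ)⁻¹ : ℝ) : ℂ))
      (-Complex.I * (h' ξ : ℂ)) ξ :=
    ((hgd ξ).mul (hinvd ξ (huIcc ▸ hξ))).ofReal_comp.const_mul _
  have hinvc : ContinuousOn (fun ξ : ℝ => (x - 2 * t * ξ)⁻¹) (Set.Icc a b) :=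
    fun ξ hξ => (hinvd ξ hξ).continuousAt.continuousWithinAt
  have hgc : Continuous g := by fun_prop
  have hEc : Continuous E := by fun_prop
  have hh'c : ContinuousOn h' (Set.Icc a b) := by fun_prop
  have hu'i : IntervalIntegrable (fun ξ => -Complex.I * (h' ξ : ℂ)) volume a b := by
    apply ContinuousOn.intervalIntegrable
    rw [huIcc]
    fun_prop
  have hparts := intervalIntegral.integral_mul_deriv_eq_deriv_mul hud (fun ξ _ => hEd ξ) hu'i
    (Continuous.intervalIntegrable (by fun_prop) _ _)
  have hlhs : ∫ ξ in a..b, glIntegrand s t x ξ =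
      ∫ ξ in a..b, -Complex.I * ((g ξ * (x - 2 * t * ξ)⁻¹ : ℝ) : ℂ) *
        (Complex.I * ((x - 2 * t * ξ : ℝ) : ℂ) * E ξ) := by
    refine intervalIntegral.integral_congr fun ξ hξ => ?_
    rw [huIcc] at hξ
    have h0 : ((x - 2 * t * ξ : ℝ) : ℂ) ≠ 0 := Complex.ofReal_ne_zero.2 (hq0 ξ hξ)
    simp only [glIntegrand, Complex.ofReal_mul, Complex.ofReal_inv]
    calc E ξ * (g ξ : ℂ) = -(Complex.I * Complex.I) *
          ((((x - 2 * t * ξ : ℝ) : ℂ))⁻¹ * ((x - 2 * t * ξ : ℝ) : ℂ)) * (E ξ * g ξ) := by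
          rw [inv_mul_cancel₀ h0, Complex.I_mul_I]; ring
      _ = _ := by ring
  have hbdry (ξ) (hξ : ξ ∈ Set.Icc a b) :
      ‖-Complex.I * ((g ξ * (x - 2 * t * ξ)⁻¹ : ℝ) : ℂ) * E ξ‖ ≤ 1 / l := by
    rw [norm_mul, norm_mul, norm_neg, Complex.norm_I, one_mul, hE, norm_e, mul_one,
      Complex.norm_real, Real.norm_eq_abs, abs_mul]
    calc |g ξ| * |(x - 2 * t * ξ)⁻¹| ≤ 1 * (1 / l) :=
          mul_le_mul (hg1 ξ) (hqinv ξ hξ) (abs_nonneg _) zero_le_one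
      _ = 1 / l := one_mul _
  have hi1 : IntervalIntegrable (fun ξ => 2 * s * |ξ| * Real.exp (-(s * ξ ^ 2)) * (1 / l))
      volume a b := Continuous.intervalIntegrable (by fun_prop) _ _
  have hi2 : IntervalIntegrable (fun ξ => 2 * t * (x - 2 * t * ξ)⁻¹ ^ 2) volume a b := by
    apply ContinuousOn.intervalIntegrable
    rw [huIcc]
    fun_prop
  have hrem : ‖∫ ξ in a..b, -Complex.I * (h' ξ : ℂ) * E ξ‖ ≤ 4 / l := by
    calc ‖∫ ξ in a..b, -Complex.I * (h' ξ : ℂ) * E ξ‖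
        ≤ ∫ ξ in a..b, (2 * s * |ξ| * Real.exp (-(s * ξ ^ 2)) * (1 / l) +
            2 * t * (x - 2 * t * ξ)⁻¹ ^ 2) := by
          refine intervalIntegral.norm_integral_le_of_norm_le hab
            (Filter.Eventually.of_forall fun ξ hξ => ?_) (hi1.add hi2)
          have hξ' : ξ ∈ Set.Icc a b := Set.Ioc_subset_Icc_self hξ
          rw [norm_mul, norm_mul, norm_neg, Complex.norm_I, one_mul, hE, norm_e, mul_one,
            Complex.norm_real, Real.norm_eq_abs]
          refine (abs_add_le _ _).trans (add_le_add ?_ ?_)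
          · rw [abs_mul, abs_neg, abs_mul, abs_mul, abs_of_nonneg (by positivity : 0 ≤ 2 * s),
              abs_of_pos (Real.exp_pos _ : 0 < g ξ)]
            exact mul_le_mul_of_nonneg_left (hqinv ξ hξ') (by positivity)
          · rw [abs_mul, abs_of_nonneg (by positivity : 0 ≤ 2 * t * (x - 2 * t * ξ)⁻¹ ^ 2)]
            exact mul_le_of_le_one_left (by positivity) (hg1 ξ)
      _ = (∫ ξ in a..b, 2 * s * |ξ| * Real.exp (-(s * ξ ^ 2))) * (1 / l) +
            ((x - 2 * t * b)⁻¹ - (x - 2 * t * a)⁻¹) := by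
          rw [intervalIntegral.integral_add hi1 hi2, intervalIntegral.integral_mul_const,
            intervalIntegral.integral_eq_sub_of_hasDerivAt (fun ξ hξ => hinvd ξ (huIcc ▸ hξ)) hi2]
      _ ≤ 2 * (1 / l) + (1 / l + 1 / l) := by
          refine add_le_add (mul_le_mul_of_nonneg_right
            (integral_abs_deriv_gaussian_le_two hs hab) (by positivity)) ?_
          have h1 := (abs_le.1 (hqinv b (Set.right_mem_Icc.2 hab))).2
          have h2 := (abs_le.1 (hqinv a (Set.left_mem_Icc.2 hab))).1
          linarith
      _ = 4 / l := by ring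
  rw [hlhs, hparts]
  calc _ ≤ 1 / l + 1 / l + 4 / l :=
        norm_sub_le_of_le (norm_sub_le_of_le (hbdry b (Set.right_mem_Icc.2 hab))
          (hbdry a (Set.left_mem_Icc.2 hab))) hrem
    _ = 6 / l := by ring

/-- Second derivative test, away from one side of the stationary point `x / (2t)`. -/
theorem norm_integral_glIntegrand_le_of_right {s t x a b d : ℝ} (hs : 0 ≤ s) (ht : 0 < t)
    (hd : 0 < d) (hab : a ≤ b) (hb : x ≤ 2 * t * a) :
    ‖∫ ξ in a..b, glIntegrand s t x ξ‖ ≤ d + 6 / (2 * t * d) := by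
  have hpos : 0 ≤ 6 / (2 * t * d) := by positivity
  rcases le_total (a + d) b with h | h
  · rw [← intervalIntegral.integral_add_adjacent_intervals (b := a + d)
      (Continuous.intervalIntegrable (by fun_prop) _ _)
      (Continuous.intervalIntegrable (by fun_prop) _ _)]
    refine norm_add_le_of_le ?_ ?_
    · simpa using norm_integral_glIntegrand_le_sub hs t x (by linarith : a ≤ a + d)
    · refine norm_integral_glIntegrand_le_of_le_abs_deriv hs ht.le h (by positivity)
        fun ξ hξ => ?_
      rw [abs_sub_comm]
      refine le_trans ?_ (le_abs_self _)
      nlinarith [hξ.1]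
  · linarith [norm_integral_glIntegrand_le_sub hs t x hab]

theorem integral_glIntegrand_neg (s t x a b : ℝ) :
    ∫ ξ in a..b, glIntegrand s t x ξ = ∫ ξ in (-b)..(-a), glIntegrand s t (-x) ξ := by
  rw [← intervalIntegral.integral_comp_neg]
  simp [glIntegrand]

theorem norm_integral_glIntegrand_le_of_left {s t x a b d : ℝ} (hs : 0 ≤ s) (ht : 0 < t)
    (hd : 0 < d) (hab : a ≤ b) (hb : 2 * t * b ≤ x) :
    ‖∫ ξ in a..b, glIntegrand s t x ξ‖ ≤ d + 6 / (2 * t * d) := by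
  rw [integral_glIntegrand_neg]
  exact norm_integral_glIntegrand_le_of_right hs ht hd (by linarith) (by linarith)

/-- Second derivative test for the kernel. -/
theorem norm_integral_glIntegrand_le_div_sqrt {s t : ℝ} (hs : 0 ≤ s) (ht : 0 < t) (x : ℝ)
    {a b : ℝ} (hab : a ≤ b) :
    ‖∫ ξ in a..b, glIntegrand s t x ξ‖ ≤ 8 / √t := by
  have hr : 0 < √t := Real.sqrt_pos.2 ht
  have hd : 0 < 1 / √t := by positivity
  have heq : 1 / √t + 6 / (2 * t * (1 / √t)) = 4 / √t := by
    have h2 : √t ^ 2 = t := Real.sq_sqrt ht.le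
    rw [← h2, Real.sqrt_sq hr.le]
    field_simp
    ring
  have hle : 4 / √t ≤ 8 / √t := by gcongr; norm_num
  rcases le_total x (2 * t * a) with ha | ha
  · exact (heq ▸ norm_integral_glIntegrand_le_of_right hs ht hd hab ha).trans hle
  rcases le_total (2 * t * b) x with hb | hb
  · exact (heq ▸ norm_integral_glIntegrand_le_of_left hs ht hd hab hb).trans hle
  have hc : 2 * t * (x / (2 * t)) = x := by field_simp
  have hac : a ≤ x / (2 * t) := by rw [le_div_iff₀ (by positivity)]; linarith
  have hcb : x / (2 * t) ≤ b := by rw [div_le_iff₀ (by positivity)]; linarith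
  rw [← intervalIntegral.integral_add_adjacent_intervals (b := x / (2 * t))
    (Continuous.intervalIntegrable (by fun_prop) _ _)
    (Continuous.intervalIntegrable (by fun_prop) _ _)]
  calc _ ≤ 4 / √t + 4 / √t := norm_add_le_of_le
        (heq ▸ norm_integral_glIntegrand_le_of_left hs ht hd hac hc.le)
        (heq ▸ norm_integral_glIntegrand_le_of_right hs ht hd hcb hc.ge)
    _ = 8 / √t := by ring

/-- A weight dominating the square of the maximal kernel: it is comparable to `1` for `|x| ≤ A`,
to `A / |x|` for `A ≤ |x| ≤ R`, and to `A R / x²` beyond. -/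
def glWeight (A R x : ℝ) : ℝ := A * R / ((A + |x|) * (R + |x|))

theorem glWeight_nonneg {A R : ℝ} (hA : 0 < A) (hR : 0 < R) (x : ℝ) : 0 ≤ glWeight A R x := by
  unfold glWeight
  positivity

theorem glWeight_le_one {A R : ℝ} (hA : 0 < A) (hR : 0 < R) (x : ℝ) : glWeight A R x ≤ 1 := by
  unfold glWeight
  refine div_le_one_of_le₀ ?_ (by positivity)
  gcongr <;> linarith [abs_nonneg x]

theorem continuous_glWeight {A R : ℝ} (hA : 0 < A) (hR : 0 < R) : Continuous (glWeight A R) := by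
  unfold glWeight
  exact continuous_const.div (by fun_prop) fun x => by positivity

theorem integral_glWeight {A R : ℝ} (hA : 0 < A) (hAR : A < R) :
    ∫ x, glWeight A R x = 2 * (A * R / (R - A) * Real.log (R / A)) := by
  have hR : 0 < R := hA.trans hAR
  have hne : R - A ≠ 0 := (sub_pos.2 hAR).ne'
  set F : ℝ → ℝ := fun x => A * R / (R - A) * Real.log ((A + x) / (R + x)) with hF
  have hderiv (x : ℝ) (hx : 0 ≤ x) : HasDerivAt F (A * R / ((A + x) * (R + x))) x := by
    have h1 : A + x ≠ 0 := by positivity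
    have h2 : R + x ≠ 0 := by positivity
    refine (((((hasDerivAt_id' x).const_add A).fun_div ((hasDerivAt_id' x).const_add R) h2).log
      (div_ne_zero h1 h2)).const_mul _).congr_deriv ?_
    field_simp
    ring
  have hlim : Filter.Tendsto F Filter.atTop (nhds 0) := by
    have h0 : Filter.Tendsto (fun x : ℝ => (A - R) / (R + x)) Filter.atTop (nhds 0) :=
      tendsto_const_nhds.div_atTop (Filter.tendsto_atTop_add_const_left _ _ Filter.tendsto_id)
    have h1 : Filter.Tendsto (fun x : ℝ => (A + x) / (R + x)) Filter.atTop (nhds 1) := by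
      have := h0.const_add 1
      rw [add_zero] at this
      refine this.congr' ?_
      filter_upwards [Filter.eventually_ge_atTop 0] with x hx
      have h2 : R + x ≠ 0 := by positivity
      field_simp
      ring
    have h2 := ((Real.continuousAt_log one_ne_zero).tendsto.comp h1).const_mul (A * R / (R - A))
    rw [Real.log_one, mul_zero] at h2
    exact h2
  have habs := integral_comp_abs (f := fun x => A * R / ((A + x) * (R + x)))
  rw [integral_Ioi_of_hasDerivAt_of_nonneg (hderiv 0 le_rfl).continuousAt.continuousWithinAt
    (fun x hx => hderiv x (le_of_lt hx))
    (fun x hx => by have : 0 < x := hx; positivity) hlim] at habs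
  unfold glWeight
  rw [habs, ← inv_div A R, Real.log_inv]
  simp [hF]

theorem integrable_glWeight {A R : ℝ} (hA : 0 < A) (hAR : A < R) : Integrable (glWeight A R) := by
  refine Integrable.of_integral_ne_zero ?_
  rw [integral_glWeight hA hAR]
  have h1 : 0 < R - A := sub_pos.2 hAR
  have h2 : 0 < Real.log (R / A) := Real.log_pos ((one_lt_div hA).2 hAR)
  have h3 : 0 < R := hA.trans hAR
  positivity

/-- The square of the frequency-localized kernel is dominated by the weight, uniformly in time. -/
theorem sq_norm_integral_glIntegrand_le {s t T a b A R : ℝ} (hs : 0 ≤ s) (ht : 0 ≤ t)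
    (htT : t ≤ T) (hab : a ≤ b) (hba : b - a ≤ 2) (hA : 1 ≤ A) (hR : 1 ≤ R) (hAR : A ≤ R)
    (hTR : 8 * A * T ≤ R) (hsub : ∀ ξ ∈ Set.Icc a b, |ξ| ≤ A) (x : ℝ) :
    ‖∫ ξ in a..b, glIntegrand s t x ξ‖ ^ 2 ≤ 2048 * glWeight A R x := by
  set J := ‖∫ ξ in a..b, glIntegrand s t x ξ‖
  have hJ0 : 0 ≤ J := norm_nonneg _
  have hA0 : 0 < A := by linarith
  have hR0 : 0 < R := by linarith
  set r := |x|
  have hr0 : 0 ≤ r := abs_nonneg x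
  change J ^ 2 ≤ 2048 * (A * R / ((A + r) * (R + r)))
  rw [← mul_div_assoc, le_div_iff₀ (by positivity)]
  rcases le_or_gt r A with hxA | hxA
  · have h1 : J ≤ 2 := (norm_integral_glIntegrand_le_sub hs t x hab).trans hba
    calc J ^ 2 * ((A + r) * (R + r)) ≤ 2 ^ 2 * ((A + A) * (R + R)) := by
          gcongr
          exact hxA.trans hAR
      _ ≤ 2048 * (A * R) := by nlinarith [mul_pos hA0 hR0]
  have hr1 : 1 ≤ r := hA.trans hxA.le
  have hrpos : 0 < r := by linarith
  rcases le_or_gt (8 * A * t) r with hxt | hxt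
  · have h1 : J ≤ 6 / (r / 2) := by
      refine norm_integral_glIntegrand_le_of_le_abs_deriv hs ht hab (by linarith) fun ξ hξ => ?_
      have h2 : |2 * t * ξ| ≤ 2 * t * A := by
        rw [abs_mul, abs_of_nonneg (by positivity)]
        exact mul_le_mul_of_nonneg_left (hsub ξ hξ) (by positivity)
      have h3 := abs_sub_abs_le_abs_sub x (2 * t * ξ)
      nlinarith
    have h2 : J * r ≤ 12 := by
      calc J * r ≤ 6 / (r / 2) * r := by gcongr
        _ = 12 := by field_simp; norm_num
    calc J ^ 2 * ((A + r) * (R + r)) ≤ J ^ 2 * ((2 * (A * r)) * (2 * (R * r))) := by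
          gcongr
          · nlinarith
          · nlinarith
      _ = 4 * (J * r) ^ 2 * (A * R) := by ring
      _ ≤ 4 * 12 ^ 2 * (A * R) := by gcongr
      _ ≤ 2048 * (A * R) := by nlinarith [mul_pos hA0 hR0]
  · have htpos : 0 < t := by
      rcases ht.eq_or_lt with h | h
      · rw [← h] at hxt; linarith
      · exact h
    have h1 : J ≤ 8 / √t := norm_integral_glIntegrand_le_div_sqrt hs htpos x hab
    have h2 : J ^ 2 ≤ 64 / t := by
      calc J ^ 2 ≤ (8 / √t) ^ 2 := by gcongr
        _ = 64 / t := by rw [div_pow, Real.sq_sqrt ht]; norm_num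
    have hrR : r ≤ R := by nlinarith
    calc J ^ 2 * ((A + r) * (R + r)) ≤ 64 / t * ((r + r) * (R + R)) := by gcongr
      _ = 256 * (r / t) * R := by ring
      _ ≤ 256 * (8 * A) * R := by
          gcongr
          rw [div_le_iff₀ htpos]
          exact hxt.le
      _ = 2048 * (A * R) := by ring

/-- The frequency-localized propagator as a convolution with its kernel. -/
theorem integral_mul_FT1_eq {s t x a b : ℝ} (hs : 0 ≤ s) (hab : a ≤ b) {u : ℝ → ℂ}
    (hu : Integrable u) (hsupp : ∀ ξ, ξ ∉ Set.Icc a b → FT1 u ξ = 0) :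
    ∫ ξ, e (x * ξ - t * ξ ^ 2) * (Real.exp (-(s * ξ ^ 2)) : ℂ) * FT1 u ξ =
      ∫ y, (∫ ξ in a..b, glIntegrand s t (x - y) ξ) * u y := by
  have hset : ∫ ξ, glIntegrand s t x ξ * FT1 u ξ =
      ∫ ξ in Set.Icc a b, glIntegrand s t x ξ * FT1 u ξ := by
    refine (setIntegral_eq_integral_of_forall_compl_eq_zero fun ξ hξ => ?_).symm
    rw [hsupp ξ hξ, mul_zero]
  have hint : Integrable (Function.uncurry fun ξ y => glIntegrand s t (x - y) ξ * u y)
      ((volume.restrict (Set.Icc a b)).prod volume) := by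
    refine Integrable.bdd_mul (c := 1) (hu.comp_snd _) ?_
      (Filter.Eventually.of_forall fun p => norm_glIntegrand_le_one hs _ _ _)
    refine Continuous.aestronglyMeasurable ?_
    unfold glIntegrand
    fun_prop
  calc _ = ∫ ξ in Set.Icc a b, glIntegrand s t x ξ * FT1 u ξ := hset
    _ = ∫ ξ in Set.Icc a b, ∫ y, glIntegrand s t (x - y) ξ * u y := by
        refine integral_congr_ae (Filter.Eventually.of_forall fun ξ => ?_)
        simp only [FT1, ← integral_const_mul]
        refine integral_congr_ae (Filter.Eventually.of_forall fun y => ?_)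
        have h : (x - y) * ξ - t * ξ ^ 2 = (x * ξ - t * ξ ^ 2) + -(y * ξ) := by ring
        simp only [glIntegrand, h, e_add]
        ring
    _ = ∫ y, ∫ ξ in Set.Icc a b, glIntegrand s t (x - y) ξ * u y := integral_integral_swap hint
    _ = _ := by
        simp only [integral_mul_const, intervalIntegral.integral_of_le hab,
          integral_Icc_eq_integral_Ioc]

/-- Cauchy–Schwarz with respect to the measure `|u| dy`, for a kernel whose square is dominated
by a bounded function. -/
theorem sq_norm_integral_mul_le {J u : ℝ → ℂ} {W : ℝ → ℝ} {c : ℝ} (hu : Integrable u)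
    (hW0 : ∀ y, 0 ≤ W y) (hWc : ∀ y, W y ≤ c) (hW : Continuous W)
    (hJ : ∀ y, ‖J y‖ ^ 2 ≤ W y) :
    ‖∫ y, J y * u y‖ ^ 2 ≤ (∫ y, W y * ‖u y‖) * ∫ y, ‖u y‖ := by
  set B := ∫ y, ‖u y‖ with hB
  have hB0 : 0 ≤ B := integral_nonneg fun y => norm_nonneg _
  have hWu : Integrable (fun y => W y * ‖u y‖) := by
    refine Integrable.bdd_mul (c := c) hu.norm hW.aestronglyMeasurable
      (Filter.Eventually.of_forall fun y => ?_)
    rw [Real.norm_of_nonneg (hW0 y)]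
    exact hWc y
  set D := ∫ y, W y * ‖u y‖ with hD
  have hD0 : 0 ≤ D := integral_nonneg fun y => mul_nonneg (hW0 y) (norm_nonneg _)
  set N := ‖∫ y, J y * u y‖
  have hN0 : 0 ≤ N := norm_nonneg _
  have key (r : ℝ) (hr : 0 ≤ r) : 2 * r * N ≤ D + r ^ 2 * B := by
    have h1 : 2 * r * N = ‖∫ y, ((2 * r : ℝ) : ℂ) * (J y * u y)‖ := by
      rw [integral_const_mul, norm_mul, Complex.norm_real, Real.norm_of_nonneg (by positivity)]
    rw [h1, hD, hB, ← integral_const_mul, ← integral_add hWu (hu.norm.const_mul _)]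
    refine norm_integral_le_of_norm_le (hWu.add (hu.norm.const_mul _))
      (Filter.Eventually.of_forall fun y => ?_)
    rw [norm_mul, norm_mul, Complex.norm_real, Real.norm_of_nonneg (by positivity)]
    have h2 : 2 * r * ‖J y‖ ≤ W y + r ^ 2 := by nlinarith [hJ y, sq_nonneg (‖J y‖ - r)]
    calc 2 * r * (‖J y‖ * ‖u y‖) = 2 * r * ‖J y‖ * ‖u y‖ := by ring
      _ ≤ (W y + r ^ 2) * ‖u y‖ := by gcongr
      _ = _ := by ring
  rcases hB0.eq_or_lt with h | h
  · have hN : N ≤ 0 := by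
      by_contra! hpos
      have := key ((D + 1) / N) (by positivity)
      rw [← h, mul_zero, add_zero, mul_assoc, div_mul_cancel₀ _ hpos.ne'] at this
      linarith
    rw [← h, mul_zero, le_antisymm hN hN0]
    norm_num
  · have := key (N / B) (by positivity)
    have h2 : 2 * (N / B) * N * B = 2 * N ^ 2 := by field_simp
    have h3 : (D + (N / B) ^ 2 * B) * B = D * B + N ^ 2 := by field_simp
    nlinarith [mul_le_mul_of_nonneg_right this h.le]

/-- Young's inequality for the square of a maximal function dominated, at each parameter, by a
weighted average against the weight `W`. -/
theorem integral_sq_iSup_le {ι : Type*} {S : Set ι} {F : ι → ℝ → ℝ} {W g : ℝ → ℝ} {c : ℝ}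
    (hW : Integrable W) (hg : Integrable g) (hW0 : ∀ y, 0 ≤ W y) (hg0 : ∀ y, 0 ≤ g y)
    (hc : 0 ≤ c) (hF : ∀ t ∈ S, ∀ x, F t x ^ 2 ≤ c * ∫ y, g y * W (x - y)) :
    ∫ x, (⨆ (t : ι) (_ : t ∈ S), |F t x|) ^ 2 ≤ c * ((∫ y, g y) * ∫ y, W y) := by
  have hconv := hg.integrable_convolution (ContinuousLinearMap.mul ℝ ℝ) hW
  have hval := integral_convolution (ContinuousLinearMap.mul ℝ ℝ) hg hW
  rw [ContinuousLinearMap.mul_apply'] at hval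
  rw [← hval, ← integral_const_mul]
  refine integral_mono_of_nonneg (Filter.Eventually.of_forall fun x => sq_nonneg _)
    (hconv.const_mul c) (Filter.Eventually.of_forall fun x => ?_)
  have hD : 0 ≤ c * ∫ y, g y * W (x - y) :=
    mul_nonneg hc (integral_nonneg fun y => mul_nonneg (hg0 y) (hW0 _))
  have hsup : ⨆ (t : ι) (_ : t ∈ S), |F t x| ≤ √(c * ∫ y, g y * W (x - y)) :=
    Real.iSup_le (fun t => Real.iSup_le (fun ht => Real.abs_le_sqrt (hF t ht x))
      (Real.sqrt_nonneg _)) (Real.sqrt_nonneg _)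
  have hsup0 : 0 ≤ ⨆ (t : ι) (_ : t ∈ S), |F t x| :=
    Real.iSup_nonneg fun t => Real.iSup_nonneg fun _ => abs_nonneg _
  calc (⨆ (t : ι) (_ : t ∈ S), |F t x|) ^ 2 ≤ √(c * ∫ y, g y * W (x - y)) ^ 2 := by gcongr
    _ = c * ∫ y, g y * W (x - y) := Real.sq_sqrt hD

/-- one-dimensional maximal function estimate for the Ginzburg–Landau
semigroup `G_ν(t)u₀ = (2π)⁻¹ ∫ e^{ixξ} e^{-itξ² - νtξ²} 𝓕u₀(ξ) dξ`, uniform in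
`ν ≥ 0`, with logarithmic growth in the time horizon `T`, for `u₀ ∈ L¹(ℝ)` with
`𝓕u₀` supported in `[k-1, k+1]`. -/
theorem stmt_13 :
    ∃ C : ℝ, 0 < C ∧
      ∀ (ν : ℝ), 0 ≤ ν → ∀ (T : ℝ), 0 < T → ∀ (k : ℤ),
      ∀ u₀ : ℝ → ℂ,
        Integrable u₀ →
        (∀ ξ : ℝ, ξ ∉ Set.Icc ((k : ℝ) - 1) ((k : ℝ) + 1) → FT1 u₀ ξ = 0) →
        (∫ x : ℝ,
            (⨆ (t : ℝ) (_ : t ∈ Set.Icc (0 : ℝ) T),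
                ‖(2 * Real.pi)⁻¹ •
                    ∫ ξ : ℝ,
                      e (x * ξ - t * ξ ^ 2) * (Real.exp (-(ν * t * ξ ^ 2)) : ℂ) *
                        FT1 u₀ ξ‖) ^ 2) ^ ((1 : ℝ) / 2)
          ≤ C * (1 + |(k : ℝ)|) ^ ((1 : ℝ) / 2) * Real.log (4 * (1 + T)) *
              ∫ y : ℝ, ‖u₀ y‖ := by
  refine ⟨√16384, by positivity, fun ν hν T hT k u₀ hu hsupp => ?_⟩
  set A : ℝ := 1 + |(k : ℝ)| with hAdef
  have hA : 1 ≤ A := by linarith [abs_nonneg (k : ℝ)]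
  have hA0 : 0 < A := by linarith
  set R : ℝ := 16 * (1 + T) * A with hRdef
  have hAR2 : 2 * A ≤ R := by nlinarith [mul_pos hA0 hT]
  have hAR : A < R := by linarith
  have hR : 0 < R := by linarith
  set B := ∫ y, ‖u₀ y‖ with hB
  have hB0 : 0 ≤ B := integral_nonneg fun y => norm_nonneg _
  set L := Real.log (4 * (1 + T)) with hL
  have hL1 : 1 ≤ L := by
    rw [hL, Real.le_log_iff_exp_le (by positivity)]
    linarith [Real.exp_one_lt_d9]
  set F : ℝ → ℝ → ℝ := fun t x => ‖(2 * Real.pi)⁻¹ •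
    ∫ ξ : ℝ, e (x * ξ - t * ξ ^ 2) * (Real.exp (-(ν * t * ξ ^ 2)) : ℂ) * FT1 u₀ ξ‖ with hF
  have hFsq (t) (ht : t ∈ Set.Icc 0 T) (x : ℝ) :
      F t x ^ 2 ≤ 2048 * B * ∫ y, ‖u₀ y‖ * glWeight A R (x - y) := by
    have hs : 0 ≤ ν * t := mul_nonneg hν ht.1
    have hFle : F t x ≤ ‖∫ y, (∫ ξ in ((k : ℝ) - 1)..((k : ℝ) + 1),
        glIntegrand (ν * t) t (x - y) ξ) * u₀ y‖ := by
      rw [hF, ← integral_mul_FT1_eq hs (by linarith) hu hsupp]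
      simp only
      rw [norm_smul, Real.norm_of_nonneg (by positivity)]
      refine mul_le_of_le_one_left (norm_nonneg _) (inv_le_one_of_one_le₀ ?_)
      linarith [Real.pi_gt_three]
    calc F t x ^ 2 ≤ _ ^ 2 := pow_le_pow_left₀ (norm_nonneg _) hFle 2
      _ ≤ (∫ y, 2048 * glWeight A R (x - y) * ‖u₀ y‖) * B := by
          refine sq_norm_integral_mul_le (c := 2048 * 1) hu (fun y => ?_) (fun y => ?_) ?_
            fun y => ?_
          · exact mul_nonneg (by norm_num) (glWeight_nonneg hA0 hR _)
          · exact mul_le_mul_of_nonneg_left (glWeight_le_one hA0 hR _) (by norm_num)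
          · exact ((continuous_glWeight hA0 hR).comp (continuous_sub_left x)).const_mul _
          · refine sq_norm_integral_glIntegrand_le hs ht.1 ht.2 (by linarith) (by linarith) hA
              (by linarith) hAR.le (by nlinarith) (fun ξ hξ => ?_) _
            rw [abs_le]
            constructor
            · linarith [hξ.1, neg_abs_le (k : ℝ)]
            · linarith [hξ.2, le_abs_self (k : ℝ)]
      _ = 2048 * B * ∫ y, ‖u₀ y‖ * glWeight A R (x - y) := by
          simp only [mul_assoc, integral_const_mul, mul_comm (glWeight _ _ _)]
          ring
  have hmax : ∫ x, (⨆ (t : ℝ) (_ : t ∈ Set.Icc (0 : ℝ) T), F t x) ^ 2 ≤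
      2048 * B * (B * ∫ y, glWeight A R y) := by
    have := integral_sq_iSup_le (integrable_glWeight hA0 hAR) hu.norm (glWeight_nonneg hA0 hR)
      (fun y => norm_nonneg _) (by positivity : 0 ≤ 2048 * B) hFsq
    simpa only [hF, abs_norm] using this
  have hlog : Real.log (R / A) ≤ 2 * L := by
    have h1 : R / A = 16 * (1 + T) := by rw [hRdef]; field_simp
    rw [h1, hL, ← Nat.cast_two (R := ℝ), ← Real.log_pow]
    refine Real.log_le_log (by positivity) ?_
    nlinarith
  have hweight : ∫ y, glWeight A R y ≤ 8 * A * L ^ 2 := by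
    rw [integral_glWeight hA0 hAR]
    have h1 : A * R / (R - A) ≤ 2 * A := by
      rw [div_le_iff₀ (by linarith)]
      nlinarith
    calc 2 * (A * R / (R - A) * Real.log (R / A)) ≤ 2 * (2 * A * (2 * L)) := by
          gcongr
          exact Real.log_nonneg ((one_le_div hA0).2 hAR.le)
      _ ≤ 8 * A * L ^ 2 := by nlinarith [mul_le_mul_of_nonneg_left hL1 (by positivity : 0 ≤ A * L)]
  have hfinal : ∫ x, (⨆ (t : ℝ) (_ : t ∈ Set.Icc (0 : ℝ) T), F t x) ^ 2 ≤
      16384 * A * (L * B) ^ 2 := by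
    calc _ ≤ 2048 * B * (B * (8 * A * L ^ 2)) := hmax.trans (by gcongr)
      _ = 16384 * A * (L * B) ^ 2 := by ring
  rw [← Real.sqrt_eq_rpow, ← Real.sqrt_eq_rpow]
  calc _ ≤ √(16384 * A * (L * B) ^ 2) := Real.sqrt_le_sqrt hfinal
    _ = √16384 * √A * L * B := by
        rw [Real.sqrt_mul (by positivity), Real.sqrt_mul (by norm_num),
          Real.sqrt_sq (by positivity)]
        ring
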